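/- arXiv:2603.25679 — 3 statements merged into one kernel-verified Lean document; each statement's English description precedes it below -/
import Mathlib

section
/- A ring R is left (n,d)-coherent (every finitely n-presented left R-module of projective dimension at most d is finitely (n+1)-presented) if and only if every finitely (n-1)-presented submodule of a free R-module having projective dimension at most d-1 is finitely n-presented. -/
universe u

/-- `M` is a finitely `n`-presented `R`-module. -/
def FinNPres (R : Type u) [Ring R] : ℕ → (M : Type u) → [AddCommGroup M] → [Module R M] → Prop
  | 0, M, _, _ => Module.Finite R M
  | n+1, M, _, _ => ∃ (k : ℕ) (f : (Fin k → R) →ₗ[R] M), Function.Surjective f ∧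
      FinNPres R n (LinearMap.ker f)

/-- `M` has projective dimension at most `d` (finite `d`). -/
def ProjDimLE (R : Type u) [Ring R] : ℕ → (M : Type u) → [AddCommGroup M] → [Module R M] → Prop
  | 0, M, _, _ => Module.Projective R M
  | d+1, M, _, _ => ∃ (ι : Type u) (f : (ι →₀ R) →ₗ[R] M), Function.Surjective f ∧
      ProjDimLE R d (LinearMap.ker f)

/-- Projective dimension at most `d` for `d : ℕ∞`; `d = ⊤` imposes no condition. -/
def ProjDimLE' (R : Type u) [Ring R] (d : ℕ∞) (M : Type u) [AddCommGroup M] [Module R M] : Prop :=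
  ∀ k : ℕ, (k : ℕ∞) = d → ProjDimLE R k M

/-- `R` is a left `(n,d)`-coherent ring: every finitely `n`-presented left `R`-module of
projective dimension at most `d` is finitely `(n+1)`-presented. -/
def NDCohRing (R : Type u) [Ring R] (n : ℕ) (d : ℕ∞) : Prop :=
  ∀ (M : Type u) [AddCommGroup M] [Module R M],
    FinNPres R n M → ProjDimLE' R d M → FinNPres R (n + 1) M

section Helpers

variable {R : Type u} [Ring R]

theorem nonempty_equiv_ker {L H P : Type u} [AddCommGroup L] [AddCommGroup H] [AddCommGroup P]
    [Module R L] [Module R H] [Module R P] (φ : L →ₗ[R] H) (g : H →ₗ[R] P)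
    (hφ : Function.Injective φ) (hex : Function.Exact φ g) :
    Nonempty (L ≃ₗ[R] LinearMap.ker g) :=
  ⟨(LinearEquiv.ofInjective φ hφ).trans (LinearEquiv.ofEq _ _ hex.linearMap_ker_eq.symm)⟩

theorem nonempty_split {L H P : Type u} [AddCommGroup L] [AddCommGroup H] [AddCommGroup P]
    [Module R L] [Module R H] [Module R P] [Module.Projective R P]
    (φ : L →ₗ[R] H) (g : H →ₗ[R] P)
    (hφ : Function.Injective φ) (hex : Function.Exact φ g) (hg : Function.Surjective g) :
    Nonempty (H ≃ₗ[R] L × P) := by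
  obtain ⟨l, hl⟩ := Module.projective_lifting_property g LinearMap.id hg
  exact ⟨(hex.splitSurjectiveEquiv hφ ⟨l, hl⟩).1⟩

theorem schanuel_half {P Q M : Type u} [AddCommGroup P] [AddCommGroup Q] [AddCommGroup M]
    [Module R P] [Module R Q] [Module R M] [Module.Projective R P] [Module.Projective R Q]
    (f : P →ₗ[R] M) (g : Q →ₗ[R] M) (hf : Function.Surjective f) (hg : Function.Surjective g) :
    Nonempty (LinearMap.ker (f.coprod (-g)) ≃ₗ[R] LinearMap.ker g × P) ∧
    Nonempty (LinearMap.ker (f.coprod (-g)) ≃ₗ[R] LinearMap.ker f × Q) := by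
  constructor
  · refine nonempty_split
      (((LinearMap.inr R P Q).comp (LinearMap.ker g).subtype).codRestrict _ ?_)
      ((LinearMap.fst R P Q).comp (Submodule.subtype _)) ?_ ?_ ?_
    · rintro ⟨y, hy⟩
      simpa using hy
    · rintro ⟨y, hy⟩ ⟨z, hz⟩ h
      simpa [Subtype.ext_iff] using h
    · rintro ⟨⟨x, y⟩, hxy⟩
      constructor
      · intro h
        have hx : x = 0 := by simpa using h
        subst hx
        have hy : g y = 0 := by simpa using hxy
        exact ⟨⟨y, hy⟩, rfl⟩
      · rintro ⟨⟨z, hz⟩, h⟩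
        rw [← h]
        simp
    · intro x
      obtain ⟨y, hy⟩ := hg (f x)
      exact ⟨⟨(x, y), by simp [hy]⟩, rfl⟩
  · refine nonempty_split
      (((LinearMap.inl R P Q).comp (LinearMap.ker f).subtype).codRestrict _ ?_)
      ((LinearMap.snd R P Q).comp (Submodule.subtype _)) ?_ ?_ ?_
    · rintro ⟨y, hy⟩
      simpa using hy
    · rintro ⟨y, hy⟩ ⟨z, hz⟩ h
      simpa [Subtype.ext_iff] using h
    · rintro ⟨⟨x, y⟩, hxy⟩
      constructor
      · intro h
        have hx : y = 0 := by simpa using h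
        subst hx
        have hy : f x = 0 := by simpa using hxy
        exact ⟨⟨x, hy⟩, rfl⟩
      · rintro ⟨⟨z, hz⟩, h⟩
        rw [← h]
        simp
    · intro y
      obtain ⟨x, hx⟩ := hf (g y)
      exact ⟨⟨(x, y), by simp [hx]⟩, rfl⟩

theorem FinNPres.of_equiv (n : ℕ) {M N : Type u} [AddCommGroup M] [AddCommGroup N]
    [Module R M] [Module R N] (e : M ≃ₗ[R] N) (h : FinNPres R n M) : FinNPres R n N := by
  cases n with
  | zero =>
    have : Module.Finite R M := h
    exact Module.Finite.equiv e
  | succ n =>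
    obtain ⟨k, f, hf, hk⟩ := h
    refine ⟨k, e.toLinearMap.comp f, e.surjective.comp hf, ?_⟩
    rw [LinearEquiv.ker_comp]
    exact hk

theorem FinNPres.prod_free (n : ℕ) {A : Type u} [AddCommGroup A] [Module R A] (k : ℕ)
    (h : FinNPres R n A) : FinNPres R n (A × (Fin k → R)) := by
  cases n with
  | zero =>
    have : Module.Finite R A := h
    exact (inferInstance : Module.Finite R (A × (Fin k → R)))
  | succ n =>
    obtain ⟨m, f, hf, hk⟩ := h
    let e : (Fin (m + k) → R) ≃ₗ[R] (Fin m → R) × (Fin k → R) :=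
      (LinearEquiv.funCongrLeft R R finSumFinEquiv).trans
        (LinearEquiv.sumArrowLequivProdArrow (Fin m) (Fin k) R R)
    refine ⟨m + k, (f.prodMap (LinearMap.id : (Fin k → R) →ₗ[R] _)).comp e.toLinearMap,
      (Function.Surjective.prodMap hf Function.surjective_id).comp e.surjective, ?_⟩
    obtain ⟨e'⟩ := nonempty_equiv_ker
      (e.symm.toLinearMap.comp ((LinearMap.inl R (Fin m → R) (Fin k → R)).comp
        (LinearMap.ker f).subtype))
      ((f.prodMap (LinearMap.id : (Fin k → R) →ₗ[R] _)).comp e.toLinearMap)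
      (e.symm.injective.comp (LinearMap.inl_injective.comp (Submodule.subtype_injective _)))
      (by
        intro z
        obtain ⟨⟨x, y⟩, rfl⟩ := e.symm.surjective z
        constructor
        · intro hz
          have hz' : f x = 0 ∧ y = 0 := by simpa using hz
          obtain ⟨h1, rfl⟩ := hz'
          exact ⟨⟨x, h1⟩, rfl⟩
        · rintro ⟨⟨w, hw⟩, h⟩
          rw [← h]
          simpa using hw)
    exact FinNPres.of_equiv n e' hk

theorem FinNPres.of_prod_free (n : ℕ) {A : Type u} [AddCommGroup A] [Module R A] (k : ℕ)
    (h : FinNPres R n (A × (Fin k → R))) : FinNPres R n A := by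
  cases n with
  | zero =>
    have : Module.Finite R (A × (Fin k → R)) := h
    exact Module.Finite.of_surjective (LinearMap.fst R A (Fin k → R)) LinearMap.fst_surjective
  | succ n =>
    obtain ⟨m, g, hg, hk⟩ := h
    refine ⟨m, (LinearMap.fst R A (Fin k → R)).comp g, (LinearMap.fst_surjective (R := R)).comp hg, ?_⟩
    obtain ⟨e⟩ := nonempty_split
      (Submodule.inclusion (LinearMap.ker_le_ker_comp g (LinearMap.fst R A (Fin k → R))))
      (((LinearMap.snd R A (Fin k → R)).comp g).comp
        (LinearMap.ker ((LinearMap.fst R A (Fin k → R)).comp g)).subtype)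
      (Submodule.inclusion_injective _)
      (by
        rintro ⟨x, hx⟩
        constructor
        · intro h
          exact ⟨⟨x, Prod.ext hx h⟩, rfl⟩
        · rintro ⟨⟨w, hw⟩, h⟩
          rw [← h]
          have : g w = 0 := hw
          simp [this])
      (by
        intro y
        obtain ⟨x, hx⟩ := hg (0, y)
        exact ⟨⟨x, by simp [hx]⟩, by simp [hx]⟩)
    exact FinNPres.of_equiv n e.symm (FinNPres.prod_free n k hk)

theorem FinNPres.ker (n : ℕ) {M : Type u} [AddCommGroup M] [Module R M]
    (h : FinNPres R (n + 1) M) (k : ℕ) (g : (Fin k → R) →ₗ[R] M) (hg : Function.Surjective g) :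
    FinNPres R n (LinearMap.ker g) := by
  obtain ⟨m, f, hf, hk⟩ := h
  obtain ⟨⟨e₁⟩, ⟨e₂⟩⟩ := schanuel_half f g hf hg
  exact FinNPres.of_prod_free n m
    (FinNPres.of_equiv n (e₂.symm.trans e₁) (FinNPres.prod_free n k hk))

open CategoryTheory in
theorem hasPD_ker_iff (d : ℕ) {P M : Type u} [AddCommGroup P] [Module R P]
    [AddCommGroup M] [Module R M] [Module.Projective R P] (f : P →ₗ[R] M)
    (hf : Function.Surjective f) :
    HasProjectiveDimensionLE (ModuleCat.of R M) (d + 1) ↔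
      HasProjectiveDimensionLE (ModuleCat.of R (LinearMap.ker f)) d := by
  have hS : (ShortComplex.mk (ModuleCat.ofHom (LinearMap.ker f).subtype) (ModuleCat.ofHom f)
      (by ext x; exact x.2)).ShortExact := by
    refine ShortComplex.ShortExact.mk' ?_ ?_ ?_
    · rw [ShortComplex.ShortExact.moduleCat_exact_iff_function_exact]
      exact LinearMap.exact_subtype_ker_map f
    · exact (ModuleCat.mono_iff_injective _).2 (Submodule.subtype_injective _)
    · exact (ModuleCat.epi_iff_surjective _).2 hf
  exact hS.hasProjectiveDimensionLT_X₃_iff d ((IsProjective.iff_projective P).1 inferInstance)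

open CategoryTheory in
theorem projDimLE_iff (d : ℕ) (M : Type u) [AddCommGroup M] [Module R M] :
    ProjDimLE R d M ↔ HasProjectiveDimensionLE (ModuleCat.of R M) d := by
  induction d generalizing M with
  | zero =>
    rw [← projective_iff_hasProjectiveDimensionLE_zero]
    exact IsProjective.iff_projective M
  | succ d ih =>
    constructor
    · rintro ⟨ι, f, hf, hk⟩
      exact (hasPD_ker_iff d f hf).2 ((ih _).1 hk)
    · intro h
      have hs : Function.Surjective (Finsupp.linearCombination R (id : M → M)) :=
        Finsupp.linearCombination_id_surjective R M
      exact ⟨M, _, hs, (ih _).2 ((hasPD_ker_iff d _ hs).1 h)⟩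

theorem ProjDimLE.of_equiv (d : ℕ) {M N : Type u} [AddCommGroup M] [AddCommGroup N]
    [Module R M] [Module R N] (e : M ≃ₗ[R] N) (h : ProjDimLE R d M) : ProjDimLE R d N := by
  rw [projDimLE_iff] at h ⊢
  exact CategoryTheory.hasProjectiveDimensionLT_of_iso e.toModuleIso _

theorem projDimLE_ker_iff (d : ℕ) {P M : Type u} [AddCommGroup P] [Module R P]
    [AddCommGroup M] [Module R M] [Module.Projective R P] (f : P →ₗ[R] M)
    (hf : Function.Surjective f) :
    ProjDimLE R (d + 1) M ↔ ProjDimLE R d (LinearMap.ker f) := by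
  rw [projDimLE_iff, projDimLE_iff, hasPD_ker_iff d f hf]

theorem ProjDimLE'.of_equiv (d : ℕ∞) {M N : Type u} [AddCommGroup M] [AddCommGroup N]
    [Module R M] [Module R N] (e : M ≃ₗ[R] N) (h : ProjDimLE' R d M) : ProjDimLE' R d N :=
  fun k hk => ProjDimLE.of_equiv k e (h k hk)

theorem projDimLE'_ker_iff (d : ℕ∞) (hd : 1 ≤ d) {P M : Type u} [AddCommGroup P] [Module R P]
    [AddCommGroup M] [Module R M] [Module.Projective R P] (f : P →ₗ[R] M)
    (hf : Function.Surjective f) :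
    ProjDimLE' R d M ↔ ProjDimLE' R (d - 1) (LinearMap.ker f) := by
  obtain ⟨c, rfl⟩ : ∃ c, d = c + 1 := ⟨d - 1, (tsub_add_cancel_of_le hd).symm⟩
  have hc : c + 1 - 1 = c := by
    induction c using ENat.recTopCoe with
    | top => rfl
    | coe c => norm_cast
  rw [hc]
  constructor
  · intro h k hk
    exact (projDimLE_ker_iff k f hf).1 (h (k + 1) (by rw [← hk]; rfl))
  · intro h k hk
    cases k with
    | zero =>
      rw [← hk] at hd
      simp at hd
    | succ k =>
      exact (projDimLE_ker_iff k f hf).2 (h k (by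
        induction c using ENat.recTopCoe with
        | top => simp at hk
        | coe c => norm_cast at hk ⊢; omega))

theorem exists_fin_submodule (ι : Type u) (K : Submodule R (ι →₀ R)) [Module.Finite R K] :
    ∃ (k : ℕ) (K' : Submodule R (Fin k → R)), Nonempty (K ≃ₗ[R] K') := by
  classical
  obtain ⟨S, hS⟩ := Module.Finite.iff_fg.1 ‹Module.Finite R K›
  let T : Finset ι := S.biUnion Finsupp.support
  have hK : K ≤ Finsupp.supported R R (T : Set ι) := by
    rw [← hS, Submodule.span_le]
    intro x hx
    rw [SetLike.mem_coe, Finsupp.mem_supported]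
    exact_mod_cast Finset.subset_biUnion_of_mem Finsupp.support hx
  let e : Finsupp.supported R R (T : Set ι) ≃ₗ[R] (Fin T.card → R) :=
    (Finsupp.supportedEquivFinsupp (T : Set ι)).trans
      ((Finsupp.linearEquivFunOnFinite R R T).trans
        (LinearEquiv.funCongrLeft R R T.equivFin.symm))
  let φ : K →ₗ[R] (Fin T.card → R) := e.toLinearMap.comp (Submodule.inclusion hK)
  have hφ : Function.Injective φ := e.injective.comp (Submodule.inclusion_injective hK)
  exact ⟨T.card, LinearMap.range φ, ⟨LinearEquiv.ofInjective φ hφ⟩⟩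

theorem FinNPres.finite (n : ℕ) {M : Type u} [AddCommGroup M] [Module R M]
    (h : FinNPres R n M) : Module.Finite R M := by
  cases n with
  | zero => exact h
  | succ n =>
    obtain ⟨k, f, hf, -⟩ := h
    exact Module.Finite.of_surjective f hf

end Helpers

/-- `R` is left `(n,d)`-coherent if and only if every finitely `(n-1)`-presented submodule of
a free `R`-module having projective dimension at most `d-1` is finitely `n`-presented. -/
theorem ndCohRing_iff_submodules_of_free (R : Type u) [Ring R] (n : ℕ) (hn : 1 ≤ n)
    (d : ℕ∞) (hd : 1 ≤ d) :
    NDCohRing R n d ↔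
      ∀ (ι : Type u) (K : Submodule R (ι →₀ R)),
        FinNPres R (n - 1) K → ProjDimLE' R (d - 1) K → FinNPres R n K := by
  obtain ⟨n, rfl⟩ : ∃ m, n = m + 1 := ⟨n - 1, by omega⟩
  rw [Nat.add_sub_cancel]
  constructor
  · intro hR ι K hK hpd
    have := hK.finite
    obtain ⟨k, K', ⟨e⟩⟩ := exists_fin_submodule ι K
    have hsurj := Submodule.mkQ_surjective K'
    let e' : K ≃ₗ[R] LinearMap.ker K'.mkQ :=
      e.trans (LinearEquiv.ofEq _ _ (Submodule.ker_mkQ K').symm)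
    have h := hR ((Fin k → R) ⧸ K') ⟨k, K'.mkQ, hsurj, FinNPres.of_equiv n e' hK⟩
      ((projDimLE'_ker_iff d hd K'.mkQ hsurj).2 (ProjDimLE'.of_equiv (d - 1) e' hpd))
    exact FinNPres.of_equiv (n + 1) e'.symm (FinNPres.ker (n + 1) h k K'.mkQ hsurj)
  · intro h M _ _ hM hpd
    obtain ⟨k, f, hf, hk⟩ := hM
    refine ⟨k, f, hf, ?_⟩
    let j : (Fin k → R) ≃ₗ[R] (ULift.{u} (Fin k) →₀ R) :=
      (LinearEquiv.funCongrLeft R R Equiv.ulift).trans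
        (Finsupp.linearEquivFunOnFinite R R (ULift.{u} (Fin k))).symm
    let e : LinearMap.ker f ≃ₗ[R] (LinearMap.ker f).map j.toLinearMap :=
      j.submoduleMap (LinearMap.ker f)
    exact FinNPres.of_equiv (n + 1) e.symm (h _ _ (FinNPres.of_equiv n e hk)
      (ProjDimLE'.of_equiv (d - 1) e ((projDimLE'_ker_iff d hd f hf).1 hpd)))
end

section
/- A ring R is left (n,d)-coherent if and only if FP_n^{≤d}(R) = FP_{n+j}^{≤d}(R) for every j ≥ 1, if and only if FP_n^{≤d}(R) = FP_∞^{≤d}(R), if and only if the class FP_n^{≤d}(R) is closed under kernels of epimorphisms between its objects. -/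
universe u

open CategoryTheory in
theorem aux_pd_iff (R : Type u) [Ring R] (k : ℕ) : ∀ (M : Type u) [AddCommGroup M] [Module R M],
    ProjDimLE R k M ↔ HasProjectiveDimensionLT (ModuleCat.of R M) (k + 1) := by
  induction k with
  | zero =>
    intro M _ _
    simp only [ProjDimLE, zero_add]
    rw [← projective_iff_hasProjectiveDimensionLT_one, ← IsProjective.iff_projective]
  | succ k ih =>
    intro M _ _
    have key : ∀ (ι : Type u) (f : (ι →₀ R) →ₗ[R] M), Function.Surjective f →
        (HasProjectiveDimensionLT (ModuleCat.of R M) (k + 2) ↔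
          HasProjectiveDimensionLT (ModuleCat.of R (LinearMap.ker f)) (k + 1)) := by
      intro ι f hf
      exact (LinearMap.shortExact_shortComplexKer hf).hasProjectiveDimensionLT_X₃_iff k
        ((IsProjective.iff_projective (ι →₀ R)).1 inferInstance)
    constructor
    · rintro ⟨ι, f, hf, h⟩
      exact (key ι f hf).2 ((ih _).1 h)
    · intro h
      have hs : Function.Surjective (Finsupp.linearCombination R (id : M → M)) :=
        Finsupp.linearCombination_id_surjective R M
      exact ⟨M, _, hs, (ih _).2 ((key M _ hs).1 h)⟩

open CategoryTheory in
theorem aux_pd_ker (R : Type u) [Ring R] (d : ℕ∞) {M N : Type u} [AddCommGroup M] [Module R M]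
    [AddCommGroup N] [Module R N] (f : M →ₗ[R] N) (hf : Function.Surjective f)
    (hM : ProjDimLE' R d M) (hN : ProjDimLE' R d N) : ProjDimLE' R d (LinearMap.ker f) := by
  intro k hk
  have h2 := (aux_pd_iff R k M).1 (hM k hk)
  have h3 := (aux_pd_iff R k N).1 (hN k hk)
  rw [aux_pd_iff]
  refine (LinearMap.shortExact_shortComplexKer hf).hasProjectiveDimensionLT_X₁ (k + 1) h2 ?_
  exact @hasProjectiveDimensionLT_of_ge _ _ _ _ (k + 1) (k + 1 + 1) (by omega) h3

open CategoryTheory in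
theorem aux_pd_proj (R : Type u) [Ring R] (d : ℕ∞) (M : Type u) [AddCommGroup M] [Module R M]
    [Module.Projective R M] : ProjDimLE' R d M := by
  intro k hk
  rw [aux_pd_iff]
  have h : Projective (ModuleCat.of R M) := (IsProjective.iff_projective M).1 inferInstance
  exact hasProjectiveDimensionLT_of_ge _ 1 (k + 1) (by omega)

section
variable {R : Type u} [Ring R]

theorem aux_equiv (n : ℕ) {M N : Type u} [AddCommGroup M] [Module R M]
    [AddCommGroup N] [Module R N] (e : M ≃ₗ[R] N) (h : FinNPres R n M) : FinNPres R n N := by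
  cases n with
  | zero =>
    have h' : Module.Finite R M := h
    exact Module.Finite.equiv e
  | succ n =>
    obtain ⟨k, f, hf, h⟩ := h
    refine ⟨k, e.toLinearMap ∘ₗ f, by simpa using e.surjective.comp hf, ?_⟩
    rw [LinearEquiv.ker_comp]
    exact h

theorem aux_mk (n : ℕ) {F M : Type u} [AddCommGroup M] [Module R M]
    [AddCommGroup F] [Module R F] {k : ℕ} (e : (Fin k → R) ≃ₗ[R] F) (f : F →ₗ[R] M)
    (hf : Function.Surjective f) (h : FinNPres R n (LinearMap.ker f)) : FinNPres R (n + 1) M := by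
  refine ⟨k, f ∘ₗ e.toLinearMap, by simpa using hf.comp e.surjective, ?_⟩
  refine aux_equiv n (LinearEquiv.symm ?_) h
  exact LinearEquiv.ofSubmodules e _ _ (by
    rw [LinearMap.ker_comp]
    exact Submodule.map_comap_eq_of_surjective e.surjective _)

theorem aux_sub (n : ℕ) : ∀ (M : Type u) [AddCommGroup M] [Module R M] [Subsingleton M],
    FinNPres R n M := by
  induction n with
  | zero => intro M _ _ _; exact (inferInstance : Module.Finite R M)
  | succ n ih =>
    intro M _ _ _
    exact ⟨0, 0, fun x => ⟨0, Subsingleton.elim _ _⟩, ih _⟩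

theorem aux_free (n k : ℕ) : FinNPres R n (Fin k → R) := by
  cases n with
  | zero => exact (inferInstance : Module.Finite R (Fin k → R))
  | succ n =>
    refine ⟨k, LinearMap.id, Function.surjective_id, ?_⟩
    rw [LinearMap.ker_id]
    exact aux_sub n _

theorem aux_succ (n : ℕ) : ∀ (M : Type u) [AddCommGroup M] [Module R M],
    FinNPres R (n + 1) M → FinNPres R n M := by
  induction n with
  | zero =>
    rintro M _ _ ⟨k, f, hf, h⟩
    exact Module.Finite.of_surjective f hf
  | succ n ih =>
    rintro M _ _ ⟨k, f, hf, h⟩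
    exact ⟨k, f, hf, ih _ h⟩

theorem aux_mono {n m : ℕ} (hnm : n ≤ m) (M : Type u) [AddCommGroup M] [Module R M]
    (h : FinNPres R m M) : FinNPres R n M := by
  induction m, hnm using Nat.le_induction with
  | base => exact h
  | succ m _ ih => exact ih (aux_succ m M h)

/-- extensions -/
theorem aux_ext (n : ℕ) : ∀ {K M N : Type u} [AddCommGroup K] [Module R K] [AddCommGroup M]
    [Module R M] [AddCommGroup N] [Module R N] (i : K →ₗ[R] M) (p : M →ₗ[R] N),
    Function.Injective i → Function.Exact i p → Function.Surjective p →
    FinNPres R n K → FinNPres R n N → FinNPres R n M := by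
  induction n with
  | zero =>
    intro K M N _ _ _ _ _ _ i p hi hip hp hK hN
    have hK' : Module.Finite R K := hK
    have hN' : Module.Finite R N := hN
    have h1 : Module.Finite R (LinearMap.ker p) := by
      rw [LinearMap.exact_iff.1 hip]
      infer_instance
    have h2 : Module.Finite R (M ⧸ LinearMap.ker p) :=
      Module.Finite.equiv (p.quotKerEquivOfSurjective hp).symm
    exact Module.Finite.of_submodule_quotient (LinearMap.ker p)
  | succ n ih =>
    rintro K M N _ _ _ _ _ _ i p hi hip hp ⟨a, f, hf, hK⟩ ⟨b, g, hg, hN⟩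
    obtain ⟨h, hh⟩ := Module.projective_lifting_property p g hp
    have hph : ∀ y, p (h y) = g y := fun y => by rw [← hh]; rfl
    have hpi : ∀ y, p (i y) = 0 := fun y => hip.apply_apply_eq_zero y
    let q : ((Fin a → R) × (Fin b → R)) →ₗ[R] M := LinearMap.coprod (i ∘ₗ f) h
    have hq : ∀ x y, q (x, y) = i (f x) + h y := fun x y => by simp [q]
    have e : (Fin (a + b) → R) ≃ₗ[R] ((Fin a → R) × (Fin b → R)) :=
      (LinearEquiv.funCongrLeft R R finSumFinEquiv).trans
        (LinearEquiv.sumArrowLequivProdArrow (Fin a) (Fin b) R R)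
    have lift : ∀ m, p m = 0 → ∃ x, i (f x) = m := by
      intro m hm
      obtain ⟨z, rfl⟩ := (hip m).1 hm
      obtain ⟨x, rfl⟩ := hf z
      exact ⟨x, rfl⟩
    refine aux_mk n e q ?_ ?_
    · intro m
      obtain ⟨y, hy⟩ := hg (p m)
      obtain ⟨x, hx⟩ := lift (m - h y) (by rw [map_sub, hph, hy, sub_self])
      exact ⟨(x, y), by rw [hq, hx]; abel⟩
    · let u : LinearMap.ker f →ₗ[R] LinearMap.ker q :=
        ((LinearMap.inl R (Fin a → R) (Fin b → R)) ∘ₗ (LinearMap.ker f).subtype).codRestrict _ (by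
          rintro ⟨x, hx⟩
          have hx' : f x = 0 := hx
          simp [q, hx'])
      let v : LinearMap.ker q →ₗ[R] LinearMap.ker g :=
        ((LinearMap.snd R (Fin a → R) (Fin b → R)) ∘ₗ (LinearMap.ker q).subtype).codRestrict _ (by
          rintro ⟨⟨x, y⟩, hx⟩
          have hx' : i (f x) + h y = 0 := by rw [← hq]; exact hx
          have := congrArg p hx'
          rw [map_add, hpi, hph, zero_add, map_zero] at this
          simpa using this)
      refine ih u v ?_ ?_ ?_ hK hN
      · rintro ⟨x, hx⟩ ⟨y, hy⟩ hxy
        have := congrArg (fun z => z.1.1) hxy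
        exact Subtype.ext this
      · rintro ⟨⟨x, y⟩, hx⟩
        have hx' : i (f x) + h y = 0 := by rw [← hq]; exact hx
        constructor
        · intro hy
          have hy' : y = 0 := congrArg Subtype.val hy
          subst hy'
          rw [map_zero, add_zero] at hx'
          exact ⟨⟨x, hi (by rw [hx', map_zero])⟩, rfl⟩
        · rintro ⟨z, hz⟩
          have : (0 : Fin b → R) = y := congrArg (fun z => z.1.2) hz
          exact Subtype.ext this.symm
      · rintro ⟨y, hy⟩
        obtain ⟨x, hx⟩ := lift (h y) (by rw [hph]; exact hy)
        refine ⟨⟨(-x, y), ?_⟩, rfl⟩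
        rw [LinearMap.mem_ker, hq, map_neg, map_neg, hx, neg_add_cancel]

/-- quotients -/
theorem aux_quot (n : ℕ) {K M N : Type u} [AddCommGroup K] [Module R K] [AddCommGroup M]
    [Module R M] [AddCommGroup N] [Module R N] (i : K →ₗ[R] M) (p : M →ₗ[R] N)
    (hi : Function.Injective i) (hip : Function.Exact i p) (hp : Function.Surjective p)
    (hK : FinNPres R n K) (hM : FinNPres R (n + 1) M) : FinNPres R (n + 1) N := by
  obtain ⟨a, f, hf, hL⟩ := hM
  refine ⟨a, p ∘ₗ f, by simpa using hp.comp hf, ?_⟩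
  have hK' : FinNPres R n (LinearMap.ker p) := by
    rw [LinearMap.exact_iff.1 hip]
    exact aux_equiv n (LinearEquiv.ofInjective i hi) hK
  let u : LinearMap.ker f →ₗ[R] LinearMap.ker (p ∘ₗ f) :=
    Submodule.inclusion (LinearMap.ker_le_ker_comp f p)
  let v : LinearMap.ker (p ∘ₗ f) →ₗ[R] LinearMap.ker p :=
    (f ∘ₗ (LinearMap.ker (p ∘ₗ f)).subtype).codRestrict _ (fun x => x.2)
  refine aux_ext n u v (Submodule.inclusion_injective _) ?_ ?_ hL hK'
  · rintro ⟨x, hx⟩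
    constructor
    · intro h
      exact ⟨⟨x, congrArg Subtype.val h⟩, rfl⟩
    · rintro ⟨⟨z, hz⟩, h⟩
      have hzx : z = x := congrArg Subtype.val h
      subst hzx
      exact Subtype.ext hz
  · rintro ⟨m, hm⟩
    obtain ⟨x, rfl⟩ := hf m
    exact ⟨⟨x, hm⟩, rfl⟩

/-- kernels -/
theorem aux_ker (n : ℕ) {M N : Type u} [AddCommGroup M]
    [Module R M] [AddCommGroup N] [Module R N] (f : M →ₗ[R] N)
    (hf : Function.Surjective f)
    (hM : FinNPres R n M) (hN : FinNPres R (n + 1) N) : FinNPres R n (LinearMap.ker f) := by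
  obtain ⟨a, p, hp, hL⟩ := hN
  obtain ⟨h, hh⟩ := Module.projective_lifting_property f p hf
  have hfh : ∀ y, f (h y) = p y := fun y => by rw [← hh]; rfl
  let P : Submodule R (M × (Fin a → R)) :=
    LinearMap.ker (f ∘ₗ LinearMap.fst R M (Fin a → R) - p ∘ₗ LinearMap.snd R M (Fin a → R))
  have hP : ∀ m x, (m, x) ∈ P ↔ f m = p x := fun m x => by
    simp [P, LinearMap.mem_ker, sub_eq_zero]
  have hPfin : FinNPres R n P := by
    let u : LinearMap.ker p →ₗ[R] P :=
      ((LinearMap.inr R M (Fin a → R)) ∘ₗ (LinearMap.ker p).subtype).codRestrict _ (by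
        rintro ⟨x, hx⟩
        have hx' : p x = 0 := hx
        exact (hP 0 x).2 (by rw [hx', map_zero]))
    let v : P →ₗ[R] M := (LinearMap.fst R M (Fin a → R)) ∘ₗ P.subtype
    refine aux_ext n u v ?_ ?_ ?_ hL hM
    · rintro ⟨x, hx⟩ ⟨y, hy⟩ hxy
      have := congrArg (fun z => z.1.2) hxy
      exact Subtype.ext this
    · rintro ⟨⟨m, x⟩, hx⟩
      constructor
      · intro hm
        have hm' : m = 0 := hm
        subst hm'
        exact ⟨⟨x, by rw [LinearMap.mem_ker, ← (hP 0 x).1 hx, map_zero]⟩, rfl⟩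
      · rintro ⟨z, hz⟩
        have : (0 : M) = m := congrArg (fun z => z.1.1) hz
        exact this.symm
    · intro m
      obtain ⟨x, hx⟩ := hp (f m)
      exact ⟨⟨(m, x), (hP m x).2 hx.symm⟩, rfl⟩
  let s : (Fin a → R) →ₗ[R] P := (LinearMap.prod h LinearMap.id).codRestrict _ (fun x =>
    (hP _ _).2 (hfh x))
  let t : P →ₗ[R] LinearMap.ker f :=
    ((LinearMap.fst R M (Fin a → R) - h ∘ₗ LinearMap.snd R M (Fin a → R)) ∘ₗ
      P.subtype).codRestrict _ (by
      rintro ⟨⟨m, x⟩, hx⟩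
      have := (hP m x).1 hx
      simp [LinearMap.mem_ker, this, hfh])
  have ht : Function.Surjective t := by
    rintro ⟨m, hm⟩
    have hm' : f m = 0 := hm
    exact ⟨⟨(m, 0), (hP _ _).2 (by rw [hm', map_zero])⟩, Subtype.ext (by simp [t])⟩
  cases n with
  | zero =>
    have hPfin' : Module.Finite R P := hPfin
    exact Module.Finite.of_surjective t ht
  | succ n =>
    refine aux_quot n s t ?_ ?_ ht (aux_free n a) hPfin
    · intro x y hxy
      exact congrArg (fun z => z.1.2) hxy
    · rintro ⟨⟨m, x⟩, hx⟩
      constructor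
      · intro hm
        have hm' : m - h x = 0 := congrArg Subtype.val hm
        have hm2 : m = h x := sub_eq_zero.1 hm'
        exact ⟨x, Subtype.ext (Prod.ext hm2.symm rfl)⟩
      · rintro ⟨y, hy⟩
        have h1 : h y = m := congrArg (fun z => z.1.1) hy
        have h2 : y = x := congrArg (fun z => z.1.2) hy
        subst h2
        exact Subtype.ext (sub_eq_zero.2 h1.symm)

theorem aux_coh {n : ℕ} {d : ℕ∞} (hR : NDCohRing R n d) (j : ℕ) :
    ∀ (M : Type u) [AddCommGroup M] [Module R M],
      FinNPres R n M → ProjDimLE' R d M → FinNPres R (n + j) M := by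
  induction j with
  | zero => intro M _ _ h _; exact h
  | succ j ih =>
    intro M _ _ h hd
    obtain ⟨k, f, hf, hk⟩ := hR M h hd
    exact ⟨k, f, hf, ih _ hk (aux_pd_ker R d f hf (aux_pd_proj R d _) hd)⟩

end

/-- `R` is left `(n,d)`-coherent iff `FPₙ^{≤d}(R) = FP_{n+j}^{≤d}(R)` for every `j ≥ 1`, iff
`FPₙ^{≤d}(R) = FP_∞^{≤d}(R)`, iff the class `FPₙ^{≤d}(R)` is closed under kernels of
epimorphisms between its objects. -/
theorem ndCohRing_tfae (R : Type u) [Ring R] (n : ℕ) (hn : 1 ≤ n) (d : ℕ∞) (hd : 1 ≤ d) :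
    (NDCohRing R n d ↔
      ∀ j : ℕ, 1 ≤ j → ∀ (M : Type u) [AddCommGroup M] [Module R M],
        (FinNPres R n M ∧ ProjDimLE' R d M) ↔ (FinNPres R (n + j) M ∧ ProjDimLE' R d M)) ∧
    (NDCohRing R n d ↔
      ∀ (M : Type u) [AddCommGroup M] [Module R M],
        (FinNPres R n M ∧ ProjDimLE' R d M) ↔ ((∀ k : ℕ, FinNPres R k M) ∧ ProjDimLE' R d M)) ∧
    (NDCohRing R n d ↔
      ∀ (M N : Type u) [AddCommGroup M] [Module R M] [AddCommGroup N] [Module R N]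
        (f : M →ₗ[R] N), Function.Surjective f →
        (FinNPres R n M ∧ ProjDimLE' R d M) → (FinNPres R n N ∧ ProjDimLE' R d N) →
        FinNPres R n (LinearMap.ker f) ∧ ProjDimLE' R d (LinearMap.ker f)) := by
  refine ⟨⟨?_, ?_⟩, ⟨?_, ?_⟩, ⟨?_, ?_⟩⟩
  · intro hR j _ M _ _
    exact ⟨fun h => ⟨aux_coh hR j M h.1 h.2, h.2⟩,
      fun h => ⟨aux_mono (Nat.le_add_right n j) M h.1, h.2⟩⟩
  · intro H M _ _ h hM
    exact ((H 1 le_rfl M).1 ⟨h, hM⟩).1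
  · intro hR M _ _
    exact ⟨fun h => ⟨fun k => aux_mono (Nat.le_add_left k n) M (aux_coh hR k M h.1 h.2), h.2⟩,
      fun h => ⟨h.1 n, h.2⟩⟩
  · intro H M _ _ h hM
    exact ((H M).1 ⟨h, hM⟩).1 (n + 1)
  · intro hR M N _ _ _ _ f hf hM hN
    exact ⟨aux_ker n f hf hM.1 (hR N hN.1 hN.2), aux_pd_ker R d f hf hM.2 hN.2⟩
  · intro H M _ _ h hM
    obtain ⟨k, f, hf, -⟩ := aux_mono hn M h
    exact ⟨k, f, hf, (H _ M f hf ⟨aux_free n k, aux_pd_proj R d _⟩ ⟨h, hM⟩).1⟩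
end

section
/- A finite product of rings R = R_1 × ⋯ × R_k is left (n,d)-coherent if and only if each factor R_i is left (n,d)-coherent. -/
universe u

section Helpers

/-- A kernel is determined up to isomorphism by exactness. -/
theorem kerEquivExists {R : Type u} [Ring R] {K F M : Type u} [AddCommGroup K] [Module R K]
    [AddCommGroup F] [Module R F] [AddCommGroup M] [Module R M] (j : K →ₗ[R] F) (h : F →ₗ[R] M)
    (hj : Function.Injective j) (hjh : Function.Exact j h) :
    Nonempty (K ≃ₗ[R] LinearMap.ker h) :=
  ⟨(LinearEquiv.ofInjective j hj).trans
    (LinearEquiv.ofEq _ _ (LinearMap.exact_iff.mp hjh).symm)⟩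

theorem FinNPres.equiv {R : Type u} [Ring R] {n : ℕ} {M N : Type u} [AddCommGroup M] [Module R M]
    [AddCommGroup N] [Module R N] (e : M ≃ₗ[R] N) (hM : FinNPres R n M) : FinNPres R n N := by
  cases n with
  | zero =>
    have : Module.Finite R M := hM
    exact Module.Finite.equiv e
  | succ n =>
    obtain ⟨k, f, hf, hk⟩ := hM
    refine ⟨k, e.toLinearMap ∘ₗ f, e.surjective.comp hf, ?_⟩
    rw [LinearEquiv.ker_comp]
    exact hk

theorem ProjDimLE.equiv {R : Type u} [Ring R] {n : ℕ} {M N : Type u} [AddCommGroup M] [Module R M]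
    [AddCommGroup N] [Module R N] (e : M ≃ₗ[R] N) (hM : ProjDimLE R n M) : ProjDimLE R n N := by
  cases n with
  | zero =>
    have : Module.Projective R M := hM
    exact Module.Projective.of_equiv' e
  | succ n =>
    obtain ⟨k, f, hf, hk⟩ := hM
    refine ⟨k, e.toLinearMap ∘ₗ f, e.surjective.comp hf, ?_⟩
    rw [LinearEquiv.ker_comp]
    exact hk

theorem FinNPres.mk_free {R : Type u} [Ring R] {n k : ℕ} {K F M : Type u} [AddCommGroup K]
    [Module R K] [AddCommGroup F] [Module R F] [AddCommGroup M] [Module R M]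
    (e : (Fin k → R) ≃ₗ[R] F) (j : K →ₗ[R] F) (h : F →ₗ[R] M)
    (hj : Function.Injective j) (hjh : Function.Exact j h) (hh : Function.Surjective h)
    (hK : FinNPres R n K) : FinNPres R (n + 1) M := by
  obtain ⟨e'⟩ := kerEquivExists (e.symm.toLinearMap ∘ₗ j) (h ∘ₗ e.toLinearMap)
    (e.symm.injective.comp hj) (by
      intro x
      constructor
      · intro hx
        obtain ⟨y, hy⟩ := (hjh (e x)).mp hx
        exact ⟨y, by simp [hy]⟩
      · rintro ⟨y, rfl⟩
        simpa using (hjh (j y)).mpr ⟨y, rfl⟩)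
  exact ⟨k, h ∘ₗ e.toLinearMap, hh.comp e.surjective, hK.equiv e'⟩

theorem ProjDimLE.mk_free {R : Type u} [Ring R] {n : ℕ} {k : Type u} {K F M : Type u}
    [AddCommGroup K]
    [Module R K] [AddCommGroup F] [Module R F] [AddCommGroup M] [Module R M]
    (e : (k →₀ R) ≃ₗ[R] F) (j : K →ₗ[R] F) (h : F →ₗ[R] M)
    (hj : Function.Injective j) (hjh : Function.Exact j h) (hh : Function.Surjective h)
    (hK : ProjDimLE R n K) : ProjDimLE R (n + 1) M := by
  obtain ⟨e'⟩ := kerEquivExists (e.symm.toLinearMap ∘ₗ j) (h ∘ₗ e.toLinearMap)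
    (e.symm.injective.comp hj) (by
      intro x
      constructor
      · intro hx
        obtain ⟨y, hy⟩ := (hjh (e x)).mp hx
        exact ⟨y, by simp [hy]⟩
      · rintro ⟨y, rfl⟩
        simpa using (hjh (j y)).mpr ⟨y, rfl⟩)
  exact ⟨k, h ∘ₗ e.toLinearMap, hh.comp e.surjective, hK.equiv e'⟩

theorem exact_prodMap_ker {R : Type u} [Ring R] {F F' M M' : Type u}
    [AddCommGroup F] [Module R F] [AddCommGroup M] [Module R M]
    [AddCommGroup F'] [Module R F'] [AddCommGroup M'] [Module R M']
    (f : F →ₗ[R] M) (g : F' →ₗ[R] M') :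
    Function.Exact ((LinearMap.ker f).subtype.prodMap (LinearMap.ker g).subtype)
      (f.prodMap g) := by
  rintro ⟨x, y⟩
  constructor
  · intro h
    have h1 : f x = 0 := congrArg Prod.fst h
    have h2 : g y = 0 := congrArg Prod.snd h
    exact ⟨(⟨x, h1⟩, ⟨y, h2⟩), rfl⟩
  · rintro ⟨⟨⟨a, ha⟩, ⟨b, hb⟩⟩, hab⟩
    have h1 : a = x := congrArg Prod.fst hab
    have h2 : b = y := congrArg Prod.snd hab
    subst h1 h2
    exact Prod.ext ha hb

theorem FinNPres.prod {R : Type u} [Ring R] {n : ℕ} : ∀ {M N : Type u} [AddCommGroup M]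
    [Module R M] [AddCommGroup N] [Module R N], FinNPres R n M → FinNPres R n N →
    FinNPres R n (M × N) := by
  induction n with
  | zero =>
    intro M N _ _ _ _ hM hN
    have : Module.Finite R M := hM
    have : Module.Finite R N := hN
    exact (inferInstance : Module.Finite R (M × N))
  | succ n ih =>
    rintro M N _ _ _ _ ⟨a, f, hf, hfk⟩ ⟨b, g, hg, hgk⟩
    exact FinNPres.mk_free
      ((LinearEquiv.funCongrLeft R R finSumFinEquiv).trans
        (LinearEquiv.sumArrowLequivProdArrow (Fin a) (Fin b) R R))
      ((LinearMap.ker f).subtype.prodMap (LinearMap.ker g).subtype) (f.prodMap g)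
      (Function.Injective.prodMap Subtype.val_injective Subtype.val_injective)
      (exact_prodMap_ker f g) (Function.Surjective.prodMap hf hg) (ih hfk hgk)

theorem ProjDimLE.prod {R : Type u} [Ring R] {n : ℕ} : ∀ {M N : Type u} [AddCommGroup M]
    [Module R M] [AddCommGroup N] [Module R N], ProjDimLE R n M → ProjDimLE R n N →
    ProjDimLE R n (M × N) := by
  induction n with
  | zero =>
    intro M N _ _ _ _ hM hN
    have : Module.Projective R M := hM
    have : Module.Projective R N := hN
    exact (inferInstance : Module.Projective R (M × N))
  | succ n ih =>
    rintro M N _ _ _ _ ⟨a, f, hf, hfk⟩ ⟨b, g, hg, hgk⟩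
    exact ProjDimLE.mk_free
      (Finsupp.sumFinsuppLEquivProdFinsupp R (M := R) (α := a) (β := b))
      ((LinearMap.ker f).subtype.prodMap (LinearMap.ker g).subtype) (f.prodMap g)
      (Function.Injective.prodMap Subtype.val_injective Subtype.val_injective)
      (exact_prodMap_ker f g) (Function.Surjective.prodMap hf hg) (ih hfk hgk)

/-- The kernel of a split surjection is a retract. -/
theorem ker_retract {R : Type u} [Ring R] {F Q : Type u} [AddCommGroup F] [Module R F]
    [AddCommGroup Q] [Module R Q] (f : F →ₗ[R] Q) (σ : Q →ₗ[R] F)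
    (h : f ∘ₗ σ = LinearMap.id) :
    ∃ r : F →ₗ[R] LinearMap.ker f, r ∘ₗ (LinearMap.ker f).subtype = LinearMap.id := by
  have h' : ∀ x, f (σ x) = x := fun x => LinearMap.congr_fun h x
  refine ⟨(LinearMap.id - σ ∘ₗ f).codRestrict _ (fun x => by simp [h']), ?_⟩
  ext ⟨x, hx⟩
  have hx' : f x = 0 := hx
  simp [hx']

theorem FinNPres.of_projective {R : Type u} [Ring R] {n : ℕ} : ∀ {Q : Type u} [AddCommGroup Q]
    [Module R Q] [Module.Finite R Q] [Module.Projective R Q], FinNPres R n Q := by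
  induction n with
  | zero =>
    intro Q _ _ h _
    exact h
  | succ n ih =>
    intro Q _ _ _ _
    obtain ⟨k, f, hf⟩ := Module.Finite.exists_fin' R Q
    obtain ⟨σ, hσ⟩ := Module.projective_lifting_property f LinearMap.id hf
    obtain ⟨r, hr⟩ := ker_retract f σ hσ
    have : Module.Projective R (LinearMap.ker f) := Module.Projective.of_split _ r hr
    have : Module.Finite R (LinearMap.ker f) := Module.Finite.of_surjective r
      (fun x => ⟨x, LinearMap.congr_fun hr x⟩)
    exact ⟨k, f, hf, ih⟩

theorem ProjDimLE.of_projective {R : Type u} [Ring R] {n : ℕ} : ∀ {Q : Type u} [AddCommGroup Q]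
    [Module R Q] [Module.Projective R Q], ProjDimLE R n Q := by
  induction n with
  | zero =>
    intro Q _ _ h
    exact h
  | succ n ih =>
    intro Q _ _ _
    have hf : Function.Surjective (Finsupp.linearCombination R (id : Q → Q)) :=
      Finsupp.linearCombination_id_surjective R Q
    obtain ⟨σ, hσ⟩ := Module.projective_lifting_property _ LinearMap.id hf
    obtain ⟨r, hr⟩ := ker_retract _ σ hσ
    have : Module.Projective R (LinearMap.ker (Finsupp.linearCombination R (id : Q → Q))) :=
      Module.Projective.of_split _ r hr
    exact ⟨Q, _, hf, ih⟩

theorem exact_coprod_ker {R : Type u} [Ring R] {F P K M : Type u} [AddCommGroup F] [Module R F]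
    [AddCommGroup P] [Module R P] [AddCommGroup K] [Module R K] [AddCommGroup M] [Module R M]
    (f : F →ₗ[R] P) (σ : P →ₗ[R] F) (hσ : f ∘ₗ σ = LinearMap.id)
    (j : K →ₗ[R] P) (h : P →ₗ[R] M)
    (hj : Function.Injective j) (hjh : Function.Exact j h) :
    Function.Injective ((σ ∘ₗ j).coprod (LinearMap.ker f).subtype) ∧
    Function.Exact ((σ ∘ₗ j).coprod (LinearMap.ker f).subtype) (h ∘ₗ f) := by
  have h' : ∀ x, f (σ x) = x := fun x => LinearMap.congr_fun hσ x
  constructor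
  · rw [injective_iff_map_eq_zero]
    rintro ⟨a, ⟨b, hb⟩⟩ hab
    have hb' : f b = 0 := hb
    have hab' : σ (j a) + b = 0 := by simpa using hab
    have h1 : j a = 0 := by
      have := congrArg f hab'
      simpa [h', hb'] using this
    have h2 : a = 0 := hj (by simpa using h1)
    have h3 : b = 0 := by simpa [h1] using hab'
    subst h2 h3
    rfl
  · intro x
    constructor
    · intro hx
      obtain ⟨y, hy⟩ := (hjh (f x)).mp hx
      refine ⟨(y, ⟨x - σ (f x), by simp [h']⟩), ?_⟩
      simp [hy]
    · rintro ⟨⟨a, ⟨b, hb⟩⟩, rfl⟩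
      have hb' : f b = 0 := hb
      have := (hjh (j a)).mpr ⟨a, rfl⟩
      simp [h', hb', this]

theorem FinNPres.mk_proj {R : Type u} [Ring R] {n : ℕ} {K P M : Type u} [AddCommGroup K]
    [Module R K] [AddCommGroup P] [Module R P] [AddCommGroup M] [Module R M]
    [Module.Finite R P] [Module.Projective R P] (j : K →ₗ[R] P) (h : P →ₗ[R] M)
    (hj : Function.Injective j) (hjh : Function.Exact j h) (hh : Function.Surjective h)
    (hK : FinNPres R n K) : FinNPres R (n + 1) M := by
  obtain ⟨k, f, hf⟩ := Module.Finite.exists_fin' R P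
  obtain ⟨σ, hσ⟩ := Module.projective_lifting_property f LinearMap.id hf
  obtain ⟨r, hr⟩ := ker_retract f σ hσ
  have : Module.Projective R (LinearMap.ker f) := Module.Projective.of_split _ r hr
  have : Module.Finite R (LinearMap.ker f) := Module.Finite.of_surjective r
    (fun x => ⟨x, LinearMap.congr_fun hr x⟩)
  obtain ⟨h1, h2⟩ := exact_coprod_ker f σ hσ j h hj hjh
  exact FinNPres.mk_free (LinearEquiv.refl R _) _ _ h1 h2 (hh.comp hf)
    (hK.prod FinNPres.of_projective)

theorem ProjDimLE.mk_proj {R : Type u} [Ring R] {n : ℕ} {K P M : Type u} [AddCommGroup K]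
    [Module R K] [AddCommGroup P] [Module R P] [AddCommGroup M] [Module R M]
    [Module.Projective R P] (j : K →ₗ[R] P) (h : P →ₗ[R] M)
    (hj : Function.Injective j) (hjh : Function.Exact j h) (hh : Function.Surjective h)
    (hK : ProjDimLE R n K) : ProjDimLE R (n + 1) M := by
  obtain ⟨f, hf⟩ : ∃ f : (P →₀ R) →ₗ[R] P, Function.Surjective f :=
    ⟨_, Finsupp.linearCombination_id_surjective R P⟩
  obtain ⟨σ, hσ⟩ := Module.projective_lifting_property f LinearMap.id hf
  obtain ⟨r, hr⟩ := ker_retract f σ hσ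
  have : Module.Projective R (LinearMap.ker f) := Module.Projective.of_split _ r hr
  obtain ⟨h1, h2⟩ := exact_coprod_ker f σ hσ j h hj hjh
  have h3 : ProjDimLE R n (K × LinearMap.ker f) := hK.prod ProjDimLE.of_projective
  exact ProjDimLE.mk_free (k := P) (F := P →₀ R) (LinearEquiv.refl R (P →₀ R)) _ (h ∘ₗ f) h1 h2
    (hh.comp hf) h3

theorem FinNPres.pi {R : Type u} [Ring R] {n : ℕ} (k : ℕ) : ∀ (M : Fin k → Type u)
    [∀ i, AddCommGroup (M i)] [∀ i, Module R (M i)], (∀ i, FinNPres R n (M i)) →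
    FinNPres R n (∀ i, M i) := by
  induction k with
  | zero =>
    intro M _ _ _
    have : Module.Projective R (∀ i, M i) :=
      Module.Projective.of_split (M := R) 0 0 (Subsingleton.elim _ _)
    exact FinNPres.of_projective
  | succ k ih =>
    intro M _ _ h
    exact ((h 0).prod (ih (fun i => M i.succ) (fun i => h i.succ))).equiv
      (Fin.consLinearEquiv R M)

/-- A ring `T` which is a direct factor of the ring `S`. -/
structure Fac (S T : Type u) [Ring S] [Ring T] where
  p : S →+* T
  s : T →ₙ+* S
  ps : ∀ t, p (s t) = t
  sp : ∀ x, s (p x) = s 1 * x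
  sp' : ∀ x, s (p x) = x * s 1

/-- The `T`-module `N` is the `T`-component of the `S`-module `M`. -/
structure CRel {S T : Type u} [Ring S] [Ring T] (F : Fac S T) (M N : Type u)
    [AddCommGroup M] [Module S M] [AddCommGroup N] [Module T N] where
  φ : N →+ M
  π : M →+ N
  πφ : ∀ n, π (φ n) = n
  φπ : ∀ m, φ (π m) = F.s 1 • m
  φs : ∀ (t : T) (n : N), φ (t • n) = F.s t • φ n

section RelLemmas

variable {S T : Type u} [Ring S] [Ring T] {F : Fac S T} {M N A B : Type u}
    [AddCommGroup M] [Module S M] [AddCommGroup N] [Module T N]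
    [AddCommGroup A] [Module S A] [AddCommGroup B] [Module T B]

theorem CRel.inj (r : CRel F M N) : Function.Injective r.φ :=
  Function.LeftInverse.injective r.πφ

theorem CRel.one_φ (r : CRel F M N) (n : N) : F.s 1 • r.φ n = r.φ n := by
  rw [← r.φs, one_smul]

theorem CRel.πs (r : CRel F M N) (t : T) (m : M) : r.π (F.s t • m) = t • r.π m := by
  apply r.inj
  rw [r.φπ, r.φs, r.φπ, smul_smul, smul_smul, ← map_mul, ← map_mul, one_mul, mul_one]

/-- The induced map on components. -/
def CRel.map (q : CRel F A B) (r : CRel F M N) (f : A →ₗ[S] M) : B →ₗ[T] N where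
  toFun b := r.π (f (q.φ b))
  map_add' x y := by simp
  map_smul' t x := by simp [q.φs, r.πs]

theorem CRel.φ_map (q : CRel F A B) (r : CRel F M N) (f : A →ₗ[S] M) (b : B) :
    r.φ (q.map r f b) = f (q.φ b) := by
  change r.φ (r.π (f (q.φ b))) = _
  rw [r.φπ, ← map_smul, q.one_φ]

theorem CRel.map_π (q : CRel F A B) (r : CRel F M N) (f : A →ₗ[S] M) (a : A) :
    q.map r f (q.π a) = r.π (f a) := by
  apply r.inj
  rw [q.φ_map, q.φπ, r.φπ, map_smul]

theorem CRel.map_surj (q : CRel F A B) (r : CRel F M N) (f : A →ₗ[S] M)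
    (hf : Function.Surjective f) : Function.Surjective (q.map r f) := by
  intro n
  obtain ⟨a, ha⟩ := hf (r.φ n)
  exact ⟨q.π a, by rw [q.map_π, ha, r.πφ]⟩

/-- Taking components commutes with kernels. -/
def CRel.ker (q : CRel F A B) (r : CRel F M N) (f : A →ₗ[S] M) :
    CRel F (LinearMap.ker f) (LinearMap.ker (q.map r f)) where
  φ := (q.φ.comp (LinearMap.ker (q.map r f)).subtype.toAddMonoidHom).codRestrict
    (LinearMap.ker f) (fun x => by
      have hx : q.map r f x.1 = 0 := x.2
      have := q.φ_map r f x.1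
      rw [hx, map_zero] at this
      exact this.symm)
  π := (q.π.comp (LinearMap.ker f).subtype.toAddMonoidHom).codRestrict
    (LinearMap.ker (q.map r f)) (fun x => by
      have hx : f x.1 = 0 := x.2
      have := q.map_π r f x.1
      rw [hx, map_zero] at this
      exact this)
  πφ n := Subtype.ext (q.πφ n.1)
  φπ m := Subtype.ext (q.φπ m.1)
  φs t n := Subtype.ext (q.φs t n.1)

/-- Components of finite free modules. -/
def CRel.fin (F : Fac S T) (k : ℕ) : CRel F (Fin k → S) (Fin k → T) where
  φ := F.s.toAddMonoidHom.compLeft (Fin k)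
  π := F.p.toAddMonoidHom.compLeft (Fin k)
  πφ n := funext fun i => F.ps _
  φπ m := funext fun i => F.sp _
  φs t n := funext fun i => map_mul F.s _ _

/-- Components of free modules. -/
noncomputable def CRel.finsupp (F : Fac S T) (k : Type u) : CRel F (k →₀ S) (k →₀ T) where
  φ := Finsupp.mapRange.addMonoidHom F.s.toAddMonoidHom
  π := Finsupp.mapRange.addMonoidHom F.p.toAddMonoidHom
  πφ n := Finsupp.ext fun i => F.ps _
  φπ m := Finsupp.ext fun i => F.sp _
  φs t n := Finsupp.ext fun i => map_mul F.s _ _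

end RelLemmas

theorem FinNPres.down {S T : Type u} [Ring S] [Ring T] (F : Fac S T) {n : ℕ} :
    ∀ {M N : Type u} [AddCommGroup M] [Module S M] [AddCommGroup N] [Module T N],
    CRel F M N → FinNPres S n M → FinNPres T n N := by
  induction n with
  | zero =>
    intro M N _ _ _ _ r hM
    have : Module.Finite S M := hM
    obtain ⟨k, f, hf⟩ := Module.Finite.exists_fin' S M
    exact Module.Finite.of_surjective ((CRel.fin F k).map r f) (CRel.map_surj _ _ _ hf)
  | succ n ih =>
    rintro M N _ _ _ _ r ⟨k, f, hf, hk⟩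
    exact ⟨k, (CRel.fin F k).map r f, CRel.map_surj _ _ _ hf, ih (CRel.ker _ r f) hk⟩

theorem ProjDimLE.down {S T : Type u} [Ring S] [Ring T] (F : Fac S T) {n : ℕ} :
    ∀ {M N : Type u} [AddCommGroup M] [Module S M] [AddCommGroup N] [Module T N],
    CRel F M N → ProjDimLE S n M → ProjDimLE T n N := by
  induction n with
  | zero =>
    intro M N _ _ _ _ r hM
    have : Module.Projective S M := hM
    have hf : Function.Surjective (Finsupp.linearCombination S (id : M → M)) :=
      Finsupp.linearCombination_id_surjective S M
    obtain ⟨σ, hσ⟩ := Module.projective_lifting_property _ LinearMap.id hf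
    refine Module.Projective.of_split (r.map (CRel.finsupp F M) σ)
      ((CRel.finsupp F M).map r (Finsupp.linearCombination S (id : M → M))) ?_
    refine LinearMap.ext fun x => r.inj ?_
    rw [LinearMap.comp_apply, CRel.φ_map, CRel.φ_map]
    exact LinearMap.congr_fun hσ _
  | succ n ih =>
    rintro M N _ _ _ _ r ⟨k, f, hf, hk⟩
    exact ⟨k, (CRel.finsupp F k).map r f, CRel.map_surj _ _ _ hf, ih (CRel.ker _ r f) hk⟩

/-- A `T`-linear map is `S`-linear. -/
def toS {S T : Type u} [Ring S] [Ring T] (F : Fac S T) {A B : Type u}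
    [AddCommGroup A] [Module S A] [Module T A] [AddCommGroup B] [Module S B] [Module T B]
    (hA : ∀ (x : S) (a : A), x • a = F.p x • a) (hB : ∀ (x : S) (a : B), x • a = F.p x • a)
    (f : A →ₗ[T] B) : A →ₗ[S] B where
  toFun := f
  map_add' := map_add f
  map_smul' x a := by simp [hA, hB]

theorem fin_up {S T : Type u} [Ring S] [Ring T] (F : Fac S T) (k : ℕ)
    [Module S (Fin k → T)] (h : ∀ (x : S) (a : Fin k → T), x • a = F.p x • a) :
    Module.Finite S (Fin k → T) ∧ Module.Projective S (Fin k → T) := by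
  let i : (Fin k → T) →ₗ[S] (Fin k → S) :=
    { toFun := (CRel.fin F k).φ
      map_add' := map_add _
      map_smul' := fun x a => by
        rw [h, CRel.φs, F.sp', mul_smul, CRel.one_φ]; rfl }
  let q : (Fin k → S) →ₗ[S] (Fin k → T) :=
    { toFun := (CRel.fin F k).π
      map_add' := map_add _
      map_smul' := fun x a => by
        rw [h]
        exact funext fun i => map_mul F.p _ _ }
  have hqi : ∀ x, q (i x) = x := fun x => (CRel.fin F k).πφ x
  exact ⟨Module.Finite.of_surjective q (fun x => ⟨i x, hqi x⟩),
    Module.Projective.of_split i q (LinearMap.ext hqi)⟩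

theorem finsupp_up {S T : Type u} [Ring S] [Ring T] (F : Fac S T) (k : Type u)
    [Module S (k →₀ T)] (h : ∀ (x : S) (a : k →₀ T), x • a = F.p x • a) :
    Module.Projective S (k →₀ T) := by
  let i : (k →₀ T) →ₗ[S] (k →₀ S) :=
    { toFun := (CRel.finsupp F k).φ
      map_add' := map_add _
      map_smul' := fun x a => by
        rw [h, CRel.φs, F.sp', mul_smul, CRel.one_φ]; rfl }
  let q : (k →₀ S) →ₗ[S] (k →₀ T) :=
    { toFun := (CRel.finsupp F k).π
      map_add' := map_add _
      map_smul' := fun x a => by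
        rw [h]
        exact Finsupp.ext fun i => map_mul F.p _ _ }
  have hqi : ∀ x, q (i x) = x := fun x => (CRel.finsupp F k).πφ x
  exact Module.Projective.of_split i q (LinearMap.ext hqi)

theorem exact_ker_sub {T : Type u} [Ring T] {A B : Type u}
    [AddCommGroup A] [Module T A] [AddCommGroup B] [Module T B] (f : A →ₗ[T] B) :
    Function.Exact (LinearMap.ker f).subtype f := LinearMap.exact_subtype_ker_map f

theorem FinNPres.up {S T : Type u} [Ring S] [Ring T] (F : Fac S T) {n : ℕ} :
    ∀ {N : Type u} [AddCommGroup N] [Module S N] [Module T N],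
    (∀ (x : S) (a : N), x • a = F.p x • a) → FinNPres T n N → FinNPres S n N := by
  induction n with
  | zero =>
    intro N _ _ _ h hN
    have : Module.Finite T N := hN
    obtain ⟨k, f, hf⟩ := Module.Finite.exists_fin' T N
    let _ : Module S (Fin k → T) := Module.compHom _ F.p
    have hk : ∀ (x : S) (a : Fin k → T), x • a = F.p x • a := fun _ _ => rfl
    have := (fin_up F k hk).1
    exact Module.Finite.of_surjective (toS F hk h f) hf
  | succ n ih =>
    rintro N _ _ _ h ⟨k, f, hf, hker⟩
    let _ : Module S (Fin k → T) := Module.compHom _ F.p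
    have hk : ∀ (x : S) (a : Fin k → T), x • a = F.p x • a := fun _ _ => rfl
    obtain ⟨_, _⟩ := fin_up F k hk
    let _ : Module S (LinearMap.ker f) := Module.compHom _ F.p
    have hk' : ∀ (x : S) (a : LinearMap.ker f), x • a = F.p x • a := fun _ _ => rfl
    exact FinNPres.mk_proj (toS F hk' hk (LinearMap.ker f).subtype) (toS F hk h f)
      Subtype.val_injective (exact_ker_sub f) hf (ih hk' hker)

theorem ProjDimLE.up_step {S T : Type u} [Ring S] [Ring T] (F : Fac S T) {n : ℕ}
    {P N : Type u} [AddCommGroup P] [Module S P] [Module T P] [Module.Projective S P]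
    [AddCommGroup N] [Module S N] [Module T N]
    (hP : ∀ (x : S) (a : P), x • a = F.p x • a) (hN : ∀ (x : S) (a : N), x • a = F.p x • a)
    (f : P →ₗ[T] N) (hf : Function.Surjective f) (hker : ProjDimLE T n (LinearMap.ker f))
    (ih : ∀ {N : Type u} [AddCommGroup N] [Module S N] [Module T N],
      (∀ (x : S) (a : N), x • a = F.p x • a) → ProjDimLE T n N → ProjDimLE S n N) :
    ProjDimLE S (n + 1) N := by
  let _ : Module S (LinearMap.ker f) := Module.compHom _ F.p
  have hk' : ∀ (x : S) (a : LinearMap.ker f), x • a = F.p x • a := fun _ _ => rfl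
  exact ProjDimLE.mk_proj (toS F hk' hP (LinearMap.ker f).subtype) (toS F hP hN f)
    Subtype.val_injective (exact_ker_sub f) hf (ih hk' hker)

theorem ProjDimLE.up {S T : Type u} [Ring S] [Ring T] (F : Fac S T) {n : ℕ} :
    ∀ {N : Type u} [AddCommGroup N] [Module S N] [Module T N],
    (∀ (x : S) (a : N), x • a = F.p x • a) → ProjDimLE T n N → ProjDimLE S n N := by
  induction n with
  | zero =>
    intro N _ _ _ h hN
    have : Module.Projective T N := hN
    have hf : Function.Surjective (Finsupp.linearCombination T (id : N → N)) :=
      Finsupp.linearCombination_id_surjective T N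
    obtain ⟨σ, hσ⟩ := Module.projective_lifting_property _ LinearMap.id hf
    let _ : Module S (N →₀ T) := Module.compHom _ F.p
    have hk : ∀ (x : S) (a : N →₀ T), x • a = F.p x • a := fun _ _ => rfl
    have := finsupp_up F N hk
    exact Module.Projective.of_split (toS F h hk σ)
      (toS F hk h (Finsupp.linearCombination T (id : N → N)))
      (LinearMap.ext fun x => LinearMap.congr_fun hσ x)
  | succ n ih =>
    rintro N _ _ _ h ⟨k, f, hf, hker⟩
    let _ : Module S (k →₀ T) := Module.compHom _ F.p
    have hk : ∀ (x : S) (a : k →₀ T), x • a = F.p x • a := fun _ _ => rfl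
    have hproj := finsupp_up F k hk
    exact ProjDimLE.up_step F hk h f hf hker ih

/-- Underlying group of the `T`-component of an `S`-module. -/
def Cmp {S T : Type u} [Ring S] [Ring T] (F : Fac S T) (M : Type u) [AddCommGroup M]
    [Module S M] : AddSubgroup M where
  carrier := {m | F.s 1 • m = m}
  add_mem' {a b} ha hb := by
    simp only [Set.mem_ofPred_eq] at *
    rw [smul_add, ha, hb]
  zero_mem' := smul_zero _
  neg_mem' {a} ha := by
    simp only [Set.mem_ofPred_eq] at *
    rw [smul_neg, ha]

/-- The `T`-module structure on the component. -/
instance Cmp.module {S T : Type u} [Ring S] [Ring T] (F : Fac S T) (M : Type u) [AddCommGroup M]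
    [Module S M] : Module T (Cmp F M) where
  smul t m := ⟨F.s t • m.1, by
    change F.s 1 • F.s t • m.1 = F.s t • m.1
    rw [smul_smul, ← map_mul, one_mul]⟩
  one_smul m := Subtype.ext m.2
  mul_smul a b m := Subtype.ext (by
    change F.s (a * b) • m.1 = F.s a • F.s b • m.1
    rw [map_mul, mul_smul])
  smul_zero a := Subtype.ext (smul_zero _)
  smul_add a x y := Subtype.ext (smul_add _ _ _)
  add_smul a b x := Subtype.ext (by
    change F.s (a + b) • x.1 = F.s a • x.1 + F.s b • x.1
    rw [map_add, add_smul])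
  zero_smul x := Subtype.ext (by
    change F.s 0 • x.1 = 0
    rw [map_zero, zero_smul])

/-- The component is the component. -/
def Cmp.rel {S T : Type u} [Ring S] [Ring T] (F : Fac S T) (M : Type u) [AddCommGroup M]
    [Module S M] : CRel F M (Cmp F M) where
  φ := (Cmp F M).subtype
  π := (DistribSMul.toAddMonoidHom M (F.s 1)).codRestrict (Cmp F M) (fun m => by
    change F.s 1 • F.s 1 • m = F.s 1 • m
    rw [smul_smul, ← map_mul, one_mul])
  πφ n := Subtype.ext n.2
  φπ m := rfl
  φs t n := rfl

/-- A `T`-module viewed over `S` is its own component. -/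
def CRel.self {S T : Type u} [Ring S] [Ring T] (F : Fac S T) {N : Type u} [AddCommGroup N]
    [Module S N] [Module T N] (h : ∀ (x : S) (a : N), x • a = F.p x • a) : CRel F N N where
  φ := AddMonoidHom.id N
  π := AddMonoidHom.id N
  πφ n := rfl
  φπ m := by simp [h, F.ps]
  φs t n := by simp [h, F.ps]

/-- The `i`-th factor of a product. -/
def facPi {k : ℕ} (R : Fin k → Type u) [∀ i, Ring (R i)] (i : Fin k) :
    Fac (∀ i, R i) (R i) where
  p := Pi.evalRingHom R i
  s :=
    { toFun := Pi.single i
      map_mul' := fun x y => Pi.single_mul i x y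
      map_zero' := Pi.single_zero i
      map_add' := fun x y => Pi.single_add i x y }
  ps t := Pi.single_eq_same i t
  sp x := by
    change Pi.single i (x i) = Pi.single i 1 * x
    ext j
    by_cases hj : j = i
    · subst hj; simp
    · simp [hj]
  sp' x := by
    change Pi.single i (x i) = x * Pi.single i 1
    ext j
    by_cases hj : j = i
    · subst hj; simp
    · simp [hj]

theorem pi_decomp {k : ℕ} (R : Fin k → Type u) [∀ i, Ring (R i)] (M : Type u) [AddCommGroup M]
    [Module (∀ i, R i) M] (N : Fin k → Type u) [∀ i, AddCommGroup (N i)]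
    [∀ i, Module (∀ i, R i) (N i)]
    (π : ∀ i, M →ₗ[∀ i, R i] N i) (φ : ∀ i, N i →+ M) (πφ : ∀ i n, π i (φ i n) = n)
    (φπ : ∀ i m, φ i (π i m) = (facPi R i).s 1 • m) :
    Nonempty ((∀ i, N i) ≃ₗ[∀ i, R i] M) := by
  have hone : ∑ i, (facPi R i).s 1 = 1 := Finset.univ_sum_single (1 : ∀ i, R i)
  have horth : ∀ i j, i ≠ j → (facPi R j).s 1 * (facPi R i).s 1 = 0 := by
    intro i j hij
    rw [← Fac.sp]
    change Pi.single j ((Pi.single i 1 : ∀ i, R i) j) = 0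
    rw [Pi.single_eq_of_ne hij.symm, Pi.single_zero]
  refine ⟨(LinearEquiv.ofBijective (LinearMap.pi π) ⟨?_, ?_⟩).symm⟩
  · rw [injective_iff_map_eq_zero]
    intro m hm
    rw [← one_smul (∀ i, R i) m, ← hone, Finset.sum_smul]
    refine Finset.sum_eq_zero fun i _ => ?_
    rw [← φπ]
    have : π i m = 0 := congrFun hm i
    rw [this, map_zero]
  · intro v
    refine ⟨∑ i, φ i (v i), ?_⟩
    funext j
    change π j (∑ i, φ i (v i)) = v j
    rw [map_sum, Finset.sum_eq_single j]
    · exact πφ j _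
    · intro i _ hij
      have hv : (facPi R i).s 1 • φ i (v i) = φ i (v i) := by rw [← φπ, πφ]
      rw [← πφ j (π j (φ i (v i))), φπ, ← hv, smul_smul, horth i j hij, zero_smul, map_zero]
    · simp

theorem FinNPres.glue {k : ℕ} (R : Fin k → Type u) [∀ i, Ring (R i)] (n : ℕ) (M : Type u)
    [AddCommGroup M] [Module (∀ i, R i) M]
    (hM : ∀ i, FinNPres (R i) n (Cmp (facPi R i) M)) : FinNPres (∀ i, R i) n M := by
  have key : ∀ i, ∃ (N : Type u) (_ : AddCommGroup N) (_ : Module (∀ i, R i) N)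
      (π : M →ₗ[∀ i, R i] N) (φ : N →+ M), (∀ n, π (φ n) = n) ∧
      (∀ m, φ (π m) = (facPi R i).s 1 • m) ∧ FinNPres (∀ i, R i) n N := by
    intro i
    let _ : Module (∀ i, R i) (Cmp (facPi R i) M) := Module.compHom _ (facPi R i).p
    have h : ∀ (x : ∀ i, R i) (a : Cmp (facPi R i) M),
        x • a = (facPi R i).p x • a := fun _ _ => rfl
    let r := Cmp.rel (facPi R i) M
    refine ⟨Cmp (facPi R i) M, inferInstance, inferInstance,
      { toFun := r.π
        map_add' := map_add r.π
        map_smul' := fun x m => ?_ }, r.φ, r.πφ, r.φπ, (hM i).up (facPi R i) h⟩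
    apply r.inj
    rw [RingHom.id_apply, h, r.φs, r.φπ, r.φπ, smul_smul, smul_smul, ← Fac.sp, Fac.sp' _ x,
      mul_assoc, ← map_mul, one_mul]
  choose N i1 i2 π φ h1 h2 h3 using key
  obtain ⟨e⟩ := pi_decomp R M N π φ h1 h2
  exact (FinNPres.pi k N h3).equiv e

end Helpers

/-- A finite product of rings is left `(n,d)`-coherent if and only if each factor is left
`(n,d)`-coherent. -/
theorem ndCohRing_pi_iff (k : ℕ) (R : Fin k → Type u) [∀ i, Ring (R i)]
    (n : ℕ) (hn : 1 ≤ n) (d : ℕ∞) (hd : 1 ≤ d) :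
    NDCohRing (∀ i, R i) n d ↔ ∀ i, NDCohRing (R i) n d := by
  constructor
  · intro hS i M _ _ hM hpd
    let F := facPi R i
    let _ : Module (∀ i, R i) M := Module.compHom M F.p
    have h : ∀ (x : ∀ i, R i) (a : M), x • a = F.p x • a := fun _ _ => rfl
    exact (hS M (hM.up F h) (fun k hk => (hpd k hk).up F h)).down F (CRel.self F h)
  · intro hR M _ _ hM hpd
    refine FinNPres.glue R (n + 1) M fun i => hR i _ ?_ ?_
    · exact hM.down (facPi R i) (Cmp.rel (facPi R i) M)
    · exact fun k hk => (hpd k hk).down (facPi R i) (Cmp.rel (facPi R i) M)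
end
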